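/- Let X and Y be compact Hausdorff spaces, let EX and EY be extremally disconnected compact Hausdorff spaces, let π_X : EX → X and π_Y : EY → Y be continuous irreducible surjections, and let f : X → Y be a quasi-open continuous map. Then there exists exactly one continuous map f̄ : EX → EY such that f ∘ π_X = π_Y ∘ f̄. -/

import Mathlib

/-- A continuous map is *quasi-open* if the image of every nonempty open set
has nonempty interior. -/
def QuasiOpen {X Y : Type*} [TopologicalSpace X] [TopologicalSpace Y] (f : X → Y) : Prop :=
  ∀ U : Set X, IsOpen U → U.Nonempty → (interior (f '' U)).Nonempty

/-- A map is *irreducible* if it is surjective and the image of every proper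
closed subset is proper. -/
def IrreducibleMap {X Y : Type*} [TopologicalSpace X] [TopologicalSpace Y] (p : X → Y) : Prop :=
  Function.Surjective p ∧ ∀ F : Set X, IsClosed F → F ≠ Set.univ → p '' F ≠ Set.univ

/-- Gleason's theorem with spaces in arbitrary universes. -/
theorem gleason_lift.{a, b, c} {A : Type a} {B : Type b} {C : Type c}
    [TopologicalSpace A] [TopologicalSpace B] [TopologicalSpace C]
    [CompactSpace A] [T2Space A] [ExtremallyDisconnected A]
    [CompactSpace B] [T2Space B] [CompactSpace C] [T2Space C]
    (φ : A → C) (p : B → C) (hφ : Continuous φ) (hp : Continuous p)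
    (hs : Function.Surjective p) : ∃ h : A → B, Continuous h ∧ p ∘ h = φ := by
  have : ExtremallyDisconnected (ULift.{max b c} A) :=
    extremallyDisconnected_of_homeo Homeomorph.ulift.symm
  obtain ⟨h, hc, he⟩ := CompactT2.ExtremallyDisconnected.projective (A := ULift.{max b c} A)
    (Y := ULift.{max a c} B) (Z := ULift.{max a b} C)
    (f := fun x => ULift.up (φ x.down)) (g := fun x => ULift.up (p x.down))
    (by fun_prop) (by fun_prop)
    (fun z => by
      obtain ⟨y, hy⟩ := hs z.down
      exact ⟨ULift.up y, by simp [hy]⟩)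
  refine ⟨fun x => (h (ULift.up x)).down, by fun_prop, ?_⟩
  funext x
  exact congrArg ULift.down (congrFun he (ULift.up x))

/-- The image of a nonempty open set under an irreducible map has nonempty interior. -/
theorem quasiOpen_of_irreducible {E X : Type*} [TopologicalSpace E] [TopologicalSpace X]
    [CompactSpace E] [T2Space X] (p : E → X) (hp : Continuous p) (hi : IrreducibleMap p) :
    QuasiOpen p := by
  intro U hU hne
  have h1 : p '' Uᶜ ≠ Set.univ := hi.2 _ hU.isClosed_compl (by simpa using hne.ne_empty)
  have h2 : IsClosed (p '' Uᶜ) := (hU.isClosed_compl.isCompact.image hp).isClosed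
  obtain ⟨y, hy⟩ := (Set.ne_univ_iff_exists_notMem _).1 h1
  refine ⟨y, mem_interior.2 ⟨(p '' Uᶜ)ᶜ, ?_, h2.isOpen_compl, hy⟩⟩
  intro z hz
  obtain ⟨e, rfl⟩ := hi.1 z
  by_contra hcon
  exact hz ⟨e, fun he => hcon ⟨e, he, rfl⟩, rfl⟩

theorem existsUnique_lift_of_quasiOpen
    {X Y EX EY : Type*} [TopologicalSpace X] [TopologicalSpace Y]
    [TopologicalSpace EX] [TopologicalSpace EY]
    [CompactSpace X] [T2Space X] [CompactSpace Y] [T2Space Y]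
    [CompactSpace EX] [T2Space EX] [ExtremallyDisconnected EX]
    [CompactSpace EY] [T2Space EY] [ExtremallyDisconnected EY]
    (πX : EX → X) (πY : EY → Y) (hπX : Continuous πX) (hπY : Continuous πY)
    (hiX : IrreducibleMap πX) (hiY : IrreducibleMap πY)
    (f : X → Y) (hf : Continuous f) (hq : QuasiOpen f) :
    ∃! fb : EX → EY, Continuous fb ∧ f ∘ πX = πY ∘ fb := by
  obtain ⟨g, hg, hgf⟩ := gleason_lift (f ∘ πX) πY (hf.comp hπX) hπY hiY.1
  refine ⟨g, ⟨hg, hgf.symm⟩, ?_⟩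
  rintro k ⟨hk, hkf⟩
  funext x
  by_contra hne
  obtain ⟨U, V, hU, hV, hxU, hxV, hUV⟩ := t2_separation hne
  -- the open set on which the two lifts are separated
  have hW : IsOpen (k ⁻¹' U ∩ g ⁻¹' V) := (hU.preimage hk).inter (hV.preimage hg)
  have h1 := quasiOpen_of_irreducible πX hπX hiX _ hW ⟨x, hxU, hxV⟩
  obtain ⟨y, hy⟩ := hq _ isOpen_interior h1
  set O := interior (f '' interior (πX '' (k ⁻¹' U ∩ g ⁻¹' V))) with hO
  have hmem : ∀ z ∈ O, (∃ u ∈ U, πY u = z) ∧ ∃ v ∈ V, πY v = z := by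
    intro z hz
    obtain ⟨w, hw, rfl⟩ := interior_subset hz
    obtain ⟨e, ⟨heU, heV⟩, rfl⟩ := interior_subset hw
    exact ⟨⟨k e, heU, (congrFun hkf e).symm⟩, ⟨g e, heV, congrFun hgf e⟩⟩
  have hOo : IsOpen O := isOpen_interior
  have hU' : IsOpen (U ∩ πY ⁻¹' O) := hU.inter (hOo.preimage hπY)
  obtain ⟨⟨u, huU, huy⟩, -⟩ := hmem y hy
  have huO : u ∈ U ∩ πY ⁻¹' O := ⟨huU, by rw [Set.mem_preimage, huy]; exact hy⟩
  refine hiY.2 (U ∩ πY ⁻¹' O)ᶜ hU'.isClosed_compl ?_ ?_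
  · intro h
    have : u ∈ (U ∩ πY ⁻¹' O)ᶜ := h ▸ Set.mem_univ u
    exact this huO
  · refine Set.eq_univ_of_forall fun z => ?_
    by_cases hz : z ∈ O
    · obtain ⟨-, v, hvV, hvz⟩ := hmem z hz
      exact ⟨v, fun hv => Set.disjoint_left.1 hUV hv.1 hvV, hvz⟩
    · obtain ⟨e, rfl⟩ := hiY.1 z
      exact ⟨e, fun he => hz he.2, rfl⟩
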